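/- Let n ≥ 5 be odd, p ≥ 1, let H_1,…,H_p be real symmetric n×n matrices and c ≥ 0 a real number. Set ε_n = 4/(n³−2n²−n−2). Assume that for every pair of orthonormal unit vectors u, v ∈ ℝⁿ one has Ric(u) + Ric(v) > 2(n−2−ε_n)(c+H²). Then for every integer q with 2 ≤ q ≤ (n−1)/2 and every orthonormal basis e_1,…,e_n of ℝⁿ, Σ_{k=q+1}^n Σ_{i=1}^q [2‖h(e_i,e_k)‖² − ⟨h(e_i,e_i), h(e_k,e_k)⟩] < q(n−q)c. -/

import Mathlib

open Matrix BigOperators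

noncomputable section

/-- Squared mean curvature `H² = Σ_α (tr H_α / n)²`. -/
def meanCurvSq (n p : ℕ) (Hm : Fin p → Matrix (Fin n) (Fin n) ℝ) : ℝ :=
  ∑ α, ((Hm α).trace / n) ^ 2

/-- `S = Σ_α ‖H_α‖²` (squared Frobenius norm of the second fundamental form). -/
def sqNormSff (n p : ℕ) (Hm : Fin p → Matrix (Fin n) (Fin n) ℝ) : ℝ :=
  ∑ α, ∑ i, ∑ j, (Hm α i j) ^ 2

/-- Scalar curvature `R = n(n−1)c + n²H² − S`. -/
def scalarCurv (n p : ℕ) (Hm : Fin p → Matrix (Fin n) (Fin n) ℝ) (c : ℝ) : ℝ :=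
  n * (n - 1) * c + n ^ 2 * meanCurvSq n p Hm - sqNormSff n p Hm

/-- Ricci curvature of a unit vector `u`, via the Gauss equation:
`Ric(u) = (n−1)c + Σ_α (tr(H_α)⟨H_α u,u⟩ − ‖H_α u‖²)`. -/
def ricci (n p : ℕ) (Hm : Fin p → Matrix (Fin n) (Fin n) ℝ) (c : ℝ) (u : Fin n → ℝ) : ℝ :=
  (n - 1) * c + ∑ α, ((Hm α).trace * ((Hm α).mulVec u ⬝ᵥ u)
    - (Hm α).mulVec u ⬝ᵥ (Hm α).mulVec u)

/-- Second fundamental form `h(u,v) = (⟨H_1 u,v⟩,…,⟨H_p u,v⟩) ∈ ℝ^p`. -/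
def sff (n p : ℕ) (Hm : Fin p → Matrix (Fin n) (Fin n) ℝ) (u v : Fin n → ℝ) : Fin p → ℝ :=
  fun α => (Hm α).mulVec u ⬝ᵥ v

/-- Euclidean inner product `⟨h(u,v), h(w,z)⟩` in `ℝ^p`. -/
def sffInner (n p : ℕ) (Hm : Fin p → Matrix (Fin n) (Fin n) ℝ) (u v w z : Fin n → ℝ) : ℝ :=
  ∑ α, sff n p Hm u v α * sff n p Hm w z α

/-- If all pairwise sums of a family on `s` exceed `2 * M`, its sum exceeds `#s * M`. -/
theorem card_mul_lt_sum_of_pairwise {ι : Type*} [DecidableEq ι] (s : Finset ι) (f : ι → ℝ)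
    (M : ℝ) (hs : 2 ≤ s.card)
    (h : ∀ i ∈ s, ∀ j ∈ s, i ≠ j → 2 * M < f i + f j) :
    (s.card : ℝ) * M < ∑ i ∈ s, f i := by
  have hs' : (2 : ℝ) ≤ s.card := by exact_mod_cast hs
  have key : ∀ i ∈ s, 2 * ((s.card : ℝ) - 1) * M < ((s.card : ℝ) - 2) * f i + ∑ j ∈ s, f j := by
    intro i hi
    have hcard : ((s.erase i).card : ℝ) = s.card - 1 := by
      rw [Finset.card_erase_of_mem hi, Nat.cast_sub (by omega), Nat.cast_one]
    have hne : (s.erase i).Nonempty := by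
      rw [← Finset.card_pos, Finset.card_erase_of_mem hi]
      omega
    have hlt : ∑ _j ∈ s.erase i, 2 * M < ∑ j ∈ s.erase i, (f i + f j) :=
      Finset.sum_lt_sum_of_nonempty hne fun j hj =>
        h i hi j (Finset.mem_of_mem_erase hj) (Finset.ne_of_mem_erase hj).symm
    rw [Finset.sum_add_distrib, Finset.sum_const, Finset.sum_const, nsmul_eq_mul, nsmul_eq_mul,
      hcard] at hlt
    have := Finset.add_sum_erase s f hi
    linarith
  have hlt := Finset.sum_lt_sum_of_nonempty (Finset.card_pos.mp (by omega)) key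
  rw [Finset.sum_add_distrib, ← Finset.mul_sum, Finset.sum_const, Finset.sum_const, nsmul_eq_mul,
    nsmul_eq_mul, ← Finset.mul_sum] at hlt
  refine lt_of_mul_lt_mul_left (a := 2 * ((s.card : ℝ) - 1)) ?_ (by linarith)
  linarith

/-- The rows of a square matrix restricted to `s` have squared norms at least the diagonal part
plus the part in the columns outside `s`. -/
theorem sum_diag_sq_add_sum_compl_sq_le {ι : Type*} [Fintype ι] [DecidableEq ι]
    (a : ι → ι → ℝ) (s : Finset ι) :
    ∑ i ∈ s, a i i ^ 2 + ∑ i ∈ s, ∑ k ∈ sᶜ, a i k ^ 2 ≤ ∑ i ∈ s, ∑ j, a i j ^ 2 := by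
  rw [← Finset.sum_add_distrib]
  refine Finset.sum_le_sum fun i hi => ?_
  rw [← Finset.sum_add_sum_compl s fun j => a i j ^ 2]
  gcongr
  exact Finset.single_le_sum (f := fun j => a i j ^ 2) (fun j _ => sq_nonneg _) hi

/-- The algebraic estimate of the Lawson–Simons expression of a single symmetric matrix by the
partial Ricci traces over `s` and its complement. -/
theorem lawsonSimons_le {ι : Type*} [Fintype ι] [DecidableEq ι] (a : ι → ι → ℝ)
    (ha : ∀ i j, a i j = a j i) (s : Finset ι) (n q l m t : ℝ)
    (hsq : (s.card : ℝ) = q) (hsn : (sᶜ.card : ℝ) = n - q) (hq : 0 < q) (hqn : 0 < n - q)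
    (hn : 2 < n) (hl : 0 ≤ l) (hm : 0 ≤ m) (hlm : 2 ≤ l + m)
    (hm_eq : m = (q - (n - 2 * q) / (n - 2)) * (n - q) / n)
    (hl_eq : l = m + (n - 2 * q) / (n - 2)) (ht : t = ∑ i, a i i) :
    ∑ k ∈ sᶜ, ∑ i ∈ s, (2 * a i k ^ 2 - a i i * a k k) + q * (n - q) * (t / n) ^ 2
      ≤ l * (∑ i ∈ s, (∑ j, a i j ^ 2 - t * a i i) + q * (n - 1) * (t / n) ^ 2)
        + m * (∑ i ∈ sᶜ, (∑ j, a i j ^ 2 - t * a i i)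
          + (n - q) * (n - 1) * (t / n) ^ 2) := by
  have h₁ := sum_diag_sq_add_sum_compl_sq_le a s
  have h₂ := sum_diag_sq_add_sum_compl_sq_le a sᶜ
  have hd₁ := sq_sum_le_card_mul_sum_sq (s := s) (f := fun i => a i i)
  have hd₂ := sq_sum_le_card_mul_sum_sq (s := sᶜ) (f := fun i => a i i)
  have hX : ∑ i ∈ sᶜ, ∑ k ∈ sᶜᶜ, a i k ^ 2 = ∑ i ∈ s, ∑ k ∈ sᶜ, a i k ^ 2 := by
    rw [compl_compl, Finset.sum_comm]
    exact Finset.sum_congr rfl fun i _ => Finset.sum_congr rfl fun j _ => by rw [ha]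
  have hL : ∑ k ∈ sᶜ, ∑ i ∈ s, (2 * a i k ^ 2 - a i i * a k k)
      = 2 * ∑ i ∈ s, ∑ k ∈ sᶜ, a i k ^ 2 - (∑ i ∈ s, a i i) * ∑ k ∈ sᶜ, a k k := by
    rw [Finset.sum_comm, Finset.sum_mul_sum, Finset.mul_sum, ← Finset.sum_sub_distrib]
    refine Finset.sum_congr rfl fun i _ => ?_
    rw [Finset.sum_sub_distrib, Finset.mul_sum]
  have hX0 : 0 ≤ ∑ i ∈ s, ∑ k ∈ sᶜ, a i k ^ 2 :=
    Finset.sum_nonneg fun i _ => Finset.sum_nonneg fun k _ => sq_nonneg _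
  have htt : t = ∑ i ∈ s, a i i + ∑ i ∈ sᶜ, a i i := by rw [ht, Finset.sum_add_sum_compl]
  rw [hL, Finset.sum_sub_distrib, Finset.sum_sub_distrib, ← Finset.mul_sum, ← Finset.mul_sum]
  rw [hX] at h₂
  rw [hsq] at hd₁
  rw [hsn] at hd₂
  set X := ∑ i ∈ s, ∑ k ∈ sᶜ, a i k ^ 2
  set x := ∑ i ∈ s, a i i
  set y := ∑ i ∈ sᶜ, a i i
  have hx : x ^ 2 / q ≤ ∑ i ∈ s, a i i ^ 2 := by
    rw [div_le_iff₀ hq]; linarith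
  have hy : y ^ 2 / (n - q) ≤ ∑ i ∈ sᶜ, a i i ^ 2 := by
    rw [div_le_iff₀ hqn]; linarith
  have hxX : l * (x ^ 2 / q + X) ≤ l * ∑ i ∈ s, ∑ j, a i j ^ 2 := by gcongr; linarith
  have hyX : m * (y ^ 2 / (n - q) + X) ≤ m * ∑ i ∈ sᶜ, ∑ j, a i j ^ 2 := by gcongr; linarith
  have hXX : 2 * X ≤ (l + m) * X := by gcongr
  have hn2 : n - 2 ≠ 0 := by linarith
  have hn0 : n ≠ 0 := by linarith
  have hid : -(x * y) + q * (n - q) * (t / n) ^ 2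
      = l * (x ^ 2 / q - t * x + q * (n - 1) * (t / n) ^ 2)
        + m * (y ^ 2 / (n - q) - t * y + (n - q) * (n - 1) * (t / n) ^ 2) := by
    rw [hl_eq, hm_eq, htt]
    field_simp
    ring
  linarith

/-- Lower bounds for the weights used in `lawsonSimons_le`. -/
theorem lawsonSimons_weight_bounds {n q : ℝ} (hn : 5 ≤ n) (hq : 2 ≤ q) (hqn : 2 * q + 1 ≤ n) :
    0 < (q - (n - 2 * q) / (n - 2)) * (n - q) / n ∧
      2 ≤ 2 * ((q - (n - 2 * q) / (n - 2)) * (n - q) / n) + (n - 2 * q) / (n - 2) := by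
  have hd : (n - 2 * q) / (n - 2) ≤ 1 := by
    rw [div_le_one (by linarith)]; linarith
  refine ⟨div_pos (mul_pos (by linarith) (by linarith)) (by linarith), ?_⟩
  have h : 2 * ((q - (n - 2 * q) / (n - 2)) * (n - q) / n) + (n - 2 * q) / (n - 2) - 2
      = ((n - 2) * (2 * q * (n - q) - 2 * n) - (n - 2 * q) ^ 2) / (n * (n - 2)) := by
    have : n ≠ 0 := by linarith
    have : n - 2 ≠ 0 := by linarith
    field_simp
    ring
  have h' : 0 ≤ ((n - 2) * (2 * q * (n - q) - 2 * n) - (n - 2 * q) ^ 2) / (n * (n - 2)) := by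
    apply div_nonneg
    · have h₁ : 0 ≤ (n - 2) * ((q - 2) * (n - 2 - q)) :=
        mul_nonneg (by linarith) (mul_nonneg (by linarith) (by linarith))
      have h₂ : (n - 2 * q) ^ 2 ≤ (n - 4) ^ 2 := by gcongr <;> linarith
      nlinarith
    · exact mul_nonneg (by linarith) (by linarith)
  linarith

/-- The pinching constant is sharp when `n - 2 * q = 1`. -/
theorem pinching_mul_le {n q : ℝ} (hn : 5 ≤ n) (hqn : 2 * q + 1 ≤ n) :
    (q * (n - q) - (n - 2 * q) ^ 2 / (n - 2)) * (1 + 4 / (n ^ 3 - 2 * n ^ 2 - n - 2))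
      ≤ q * (n - q) := by
  have hn2 : 0 < n - 2 := by linarith
  have hD : 0 < n ^ 3 - 2 * n ^ 2 - n - 2 := by
    nlinarith [mul_nonneg (sub_nonneg.2 hn) (sub_nonneg.2 hn),
      mul_nonneg (mul_nonneg (sub_nonneg.2 hn) (sub_nonneg.2 hn)) (sub_nonneg.2 hn)]
  have hm : 1 ≤ (n - 2 * q) ^ 2 := by nlinarith
  have hW : q * (n - q) - (n - 2 * q) ^ 2 / (n - 2)
      ≤ (n ^ 3 - 2 * n ^ 2 - n - 2) / (4 * (n - 2)) := by
    have h₁ : 1 / (n - 2) ≤ (n - 2 * q) ^ 2 / (n - 2) := by gcongr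
    have h₂ : (n ^ 3 - 2 * n ^ 2 - n - 2) / (4 * (n - 2)) = (n ^ 2 - 1) / 4 - 1 / (n - 2) := by
      field_simp
      ring
    rw [h₂]
    nlinarith
  have h₃ : (q * (n - q) - (n - 2 * q) ^ 2 / (n - 2)) * (4 / (n ^ 3 - 2 * n ^ 2 - n - 2))
      ≤ (n - 2 * q) ^ 2 / (n - 2) := by
    calc _ ≤ (n ^ 3 - 2 * n ^ 2 - n - 2) / (4 * (n - 2)) *
          (4 / (n ^ 3 - 2 * n ^ 2 - n - 2)) := by gcongr
      _ = 1 / (n - 2) := by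
        rw [div_mul_div_comm, div_eq_div_iff (by positivity) hn2.ne']
        ring
      _ ≤ _ := by gcongr
  linarith

section OrthonormalFrame

variable {n : ℕ} {e : Fin n → Fin n → ℝ}

theorem transpose_mul_self_of_orthonormal
    (he : ∀ i j, e i ⬝ᵥ e j = if i = j then (1 : ℝ) else 0) :
    (Matrix.of e)ᵀ * Matrix.of e = 1 := by
  rw [_root_.mul_eq_one_comm]
  ext i j
  rw [Matrix.one_apply, ← he i j]
  rfl

theorem dotProduct_self_eq_sum_sq
    (he : ∀ i j, e i ⬝ᵥ e j = if i = j then (1 : ℝ) else 0) (v : Fin n → ℝ) :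
    v ⬝ᵥ v = ∑ j, (v ⬝ᵥ e j) ^ 2 := by
  have h : v ⬝ᵥ v = (Matrix.of e *ᵥ v) ⬝ᵥ (Matrix.of e *ᵥ v) := by
    rw [Matrix.dotProduct_mulVec, Matrix.vecMul_mulVec, ← Matrix.dotProduct_mulVec,
      transpose_mul_self_of_orthonormal he, Matrix.one_mulVec]
  rw [h]
  refine Finset.sum_congr rfl fun j _ => ?_
  rw [sq, dotProduct_comm v]
  rfl

theorem trace_eq_sum_dotProduct
    (he : ∀ i j, e i ⬝ᵥ e j = if i = j then (1 : ℝ) else 0) (A : Matrix (Fin n) (Fin n) ℝ) :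
    A.trace = ∑ i, A *ᵥ e i ⬝ᵥ e i := by
  have h : A.trace = (Matrix.of e * A * (Matrix.of e)ᵀ).trace := by
    rw [Matrix.trace_mul_comm, ← Matrix.mul_assoc, transpose_mul_self_of_orthonormal he,
      Matrix.one_mul]
  rw [h]
  refine Finset.sum_congr rfl fun i _ => ?_
  rw [Matrix.diag_apply, Matrix.mul_assoc, dotProduct_comm]
  rfl

end OrthonormalFrame

theorem stmt_18 (n p : ℕ) (hn : 5 ≤ n) (hodd : Odd n) (hp : 1 ≤ p)
    (Hm : Fin p → Matrix (Fin n) (Fin n) ℝ) (hsym : ∀ α, (Hm α).IsSymm)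
    (c : ℝ) (hc : 0 ≤ c)
    (hRic : ∀ u v : Fin n → ℝ, u ⬝ᵥ u = 1 → v ⬝ᵥ v = 1 → u ⬝ᵥ v = 0 →
      ricci n p Hm c u + ricci n p Hm c v >
        2 * ((n : ℝ) - 2 - 4 / ((n : ℝ) ^ 3 - 2 * (n : ℝ) ^ 2 - (n : ℝ) - 2))
          * (c + meanCurvSq n p Hm)) :
    ∀ q : ℕ, 2 ≤ q → 2 * q + 1 ≤ n →
      ∀ e : Fin n → Fin n → ℝ, (∀ i j, e i ⬝ᵥ e j = if i = j then (1 : ℝ) else 0) →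
        ∑ k ∈ Finset.univ.filter (fun k : Fin n => q ≤ (k : ℕ)),
            ∑ i ∈ Finset.univ.filter (fun i : Fin n => (i : ℕ) < q),
              (2 * sffInner n p Hm (e i) (e k) (e i) (e k)
                - sffInner n p Hm (e i) (e i) (e k) (e k))
          < (q : ℝ) * ((n : ℝ) - q) * c := by
  intro q hq hqn e he
  have hn' : (5 : ℝ) ≤ n := by exact_mod_cast hn
  have hq' : (2 : ℝ) ≤ q := by exact_mod_cast hq
  have hqn' : 2 * (q : ℝ) + 1 ≤ n := by exact_mod_cast hqn
  set s : Finset (Fin n) := Finset.univ.filter fun i : Fin n => (i : ℕ) < q with hs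
  have hsc : Finset.univ.filter (fun k : Fin n => q ≤ (k : ℕ)) = sᶜ := by
    ext k
    simp [hs]
  have hcard : s.card = q := by
    rw [hs, Fin.card_filter_val_lt]
    omega
  have hcardc : sᶜ.card = n - q := by rw [Finset.card_compl, hcard, Fintype.card_fin]
  have hcardR : (s.card : ℝ) = q := by rw [hcard]
  have hcardcR : (sᶜ.card : ℝ) = (n : ℝ) - q := by
    rw [hcardc, Nat.cast_sub (by omega)]
  rw [hsc]
  set ε : ℝ := 4 / ((n : ℝ) ^ 3 - 2 * (n : ℝ) ^ 2 - (n : ℝ) - 2) with hε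
  set K : ℝ := c + meanCurvSq n p Hm with hK
  have hK0 : 0 ≤ K := add_nonneg hc (Finset.sum_nonneg fun α _ => sq_nonneg _)
  have hricci : ∀ i, ricci n p Hm c (e i) = (n - 1) * c - ∑ α,
      (∑ j, sff n p Hm (e i) (e j) α ^ 2 - (Hm α).trace * sff n p Hm (e i) (e i) α) := by
    intro i
    rw [ricci, sub_eq_add_neg (_ * c), ← Finset.sum_neg_distrib]
    congr 1
    refine Finset.sum_congr rfl fun α _ => ?_
    rw [dotProduct_self_eq_sum_sq he ((Hm α) *ᵥ e i), neg_sub]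
    rfl
  have hpart : ∀ u : Finset (Fin n), 2 ≤ u.card →
      ∑ α, ∑ i ∈ u, (∑ j, sff n p Hm (e i) (e j) α ^ 2
        - (Hm α).trace * sff n p Hm (e i) (e i) α)
        + u.card * (n - 1) * meanCurvSq n p Hm < u.card * (1 + ε) * K := by
    intro u hu
    have h := card_mul_lt_sum_of_pairwise u (fun i => ricci n p Hm c (e i)) ((n - 2 - ε) * K) hu
      fun i _ j _ hij => by
        have := hRic (e i) (e j) (by simp [he]) (by simp [he]) (by simp [he, hij])
        linarith
    simp only [hricci] at h
    rw [Finset.sum_sub_distrib, Finset.sum_const, nsmul_eq_mul, Finset.sum_comm] at h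
    rw [hK] at h ⊢
    linarith
  have hA := hpart s (by omega)
  have hB := hpart sᶜ (by omega)
  rw [hcardR] at hA
  rw [hcardcR] at hB
  set d : ℝ := ((n : ℝ) - 2 * q) / (n - 2) with hd
  obtain ⟨hm0, hlm⟩ := lawsonSimons_weight_bounds hn' hq' hqn'
  rw [← hd] at hm0 hlm
  set m : ℝ := (q - d) * (n - q) / n with hm
  have hd0 : 0 ≤ d := div_nonneg (by linarith) (by linarith)
  have hsymm : ∀ α i j, sff n p Hm (e i) (e j) α = sff n p Hm (e j) (e i) α := by
    intro α i j
    rw [sff, sff, dotProduct_comm, Matrix.dotProduct_mulVec, ← Matrix.mulVec_transpose, hsym α]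
  have hLS := Finset.sum_le_sum fun α (_ : α ∈ Finset.univ) =>
    lawsonSimons_le (fun i j => sff n p Hm (e i) (e j) α) (hsymm α) s n q (m + d) m
      (Hm α).trace hcardR hcardcR (by linarith) (by linarith) (by linarith) (by linarith)
      hm0.le (by linarith) hm rfl (trace_eq_sum_dotProduct he (Hm α))
  simp only [Finset.sum_add_distrib, ← Finset.mul_sum] at hLS
  have hL : ∑ k ∈ sᶜ, ∑ i ∈ s, (2 * sffInner n p Hm (e i) (e k) (e i) (e k)
        - sffInner n p Hm (e i) (e i) (e k) (e k))
      = ∑ α, ∑ k ∈ sᶜ, ∑ i ∈ s, (2 * sff n p Hm (e i) (e k) α ^ 2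
        - sff n p Hm (e i) (e i) α * sff n p Hm (e k) (e k) α) := by
    conv_rhs => rw [Finset.sum_comm]
    refine Finset.sum_congr rfl fun k _ => ?_
    conv_rhs => rw [Finset.sum_comm]
    refine Finset.sum_congr rfl fun i _ => ?_
    simp only [sffInner, Finset.sum_sub_distrib, Finset.mul_sum, sq]
  change _ + _ * meanCurvSq n p Hm ≤ _ * (_ + _ * meanCurvSq n p Hm)
    + _ * (_ + _ * meanCurvSq n p Hm) at hLS
  rw [← hL] at hLS
  have hA' := mul_lt_mul_of_pos_left hA (show 0 < m + d by linarith)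
  have hB' := mul_lt_mul_of_pos_left hB hm0
  have hw : (m + d) * q + m * (n - q)
      = q * (n - q) - ((n : ℝ) - 2 * q) ^ 2 / (n - 2) := by
    have : (n : ℝ) ≠ 0 := by linarith
    have : (n : ℝ) - 2 ≠ 0 := by linarith
    rw [hm, hd]
    field_simp
    ring
  have hfin := mul_le_mul_of_nonneg_right (pinching_mul_le hn' hqn') hK0
  rw [← hε, ← hw] at hfin
  have hexp : (q : ℝ) * (n - q) * K = q * (n - q) * c + q * (n - q) * meanCurvSq n p Hm := by
    rw [hK]
    ring
  linarith
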